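/- Under the hypotheses of the topological lemma (f continuous on closure(B_X), local homeomorphism on B_X with bounded image, f(X) ⊆ Y), the image satisfies f(B_X) = B_Y. -/

import Mathlib

open Set

/-- A Jordan curve in the plane: a homeomorphic image of the circle. -/
def IsJordanCurve (X : Set (ℝ × ℝ)) : Prop :=
  ∃ γ : Circle → ℝ × ℝ, Continuous γ ∧ Function.Injective γ ∧ Set.range γ = X

/-- `B` is the interior (the bounded connected component of the complement)
of the Jordan curve `X`. -/
def IsJordanInterior (X B : Set (ℝ × ℝ)) : Prop :=
  Bornology.IsBounded B ∧ ∃ x ∈ Xᶜ, B = connectedComponentIn Xᶜ x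

open Topology Complex

section Logarithms

theorem exists_continuous_log {A : Type*} [TopologicalSpace A] [SimplyConnectedSpace A]
    [LocallyPathConnectedSpace A] {f : A → ℂ} (hf : Continuous f) (h0 : ∀ x, f x ≠ 0) :
    ∃ g : A → ℂ, Continuous g ∧ ∀ x, exp (g x) = f x := by
  obtain ⟨a⟩ : Nonempty A := inferInstance
  obtain ⟨g, ⟨-, hg⟩, -⟩ := isCoveringMapOn_exp.existsUnique_continuousMap_lifts
    (⟨f, hf⟩ : C(A, ℂ)) (a₀ := a) (e₀ := log (f a)) (exp_log (h0 a)) h0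
  exact ⟨g, g.continuous, congrFun hg⟩

theorem eq_of_exp_eq {A : Type*} [TopologicalSpace A] [PreconnectedSpace A] {g₁ g₂ : A → ℂ}
    (h₁ : Continuous g₁) (h₂ : Continuous g₂) (h : ∀ x, exp (g₁ x) = exp (g₂ x)) {a : A}
    (ha : g₁ a = g₂ a) : g₁ = g₂ :=
  isCoveringMap_exp.eq_of_comp_eq h₁ h₂ (funext fun x ↦ Subtype.ext (h x)) a ha

theorem exists_continuousMap_comp_eq {E : Type*} [TopologicalSpace E] [T2Space E] [NormalSpace E]
    {σ : ℝ → E} {g : ℝ → ℂ} (hσ : Continuous σ) (hg : Continuous g) (a b : ℝ)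
    (h : ∀ s ∈ Icc a b, ∀ t ∈ Icc a b, σ s = σ t → g s = g t) :
    ∃ G : C(E, ℂ), ∀ t ∈ Icc a b, G (σ t) = g t := by
  let q : C(Icc a b, σ '' Icc a b) :=
    ⟨fun t ↦ ⟨σ t, mem_image_of_mem σ t.2⟩, by fun_prop⟩
  have hq : IsQuotientMap q := by
    refine q.continuous.isClosedMap.isQuotientMap q.continuous ?_
    rintro ⟨_, t, ht, rfl⟩
    exact ⟨⟨t, ht⟩, rfl⟩
  let g' : C(Icc a b, ℂ) := ⟨fun t ↦ g t, by fun_prop⟩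
  have hfac : Function.FactorsThrough g' q := fun s t hst ↦
    h s s.2 t t.2 (congrArg Subtype.val hst)
  obtain ⟨G, hG⟩ := ContinuousMap.exists_restrict_eq (isCompact_Icc.image hσ).isClosed
    (hq.lift g' hfac)
  refine ⟨G, fun t ht ↦ ?_⟩
  have h1 := DFunLike.congr_fun hG (q ⟨t, ht⟩)
  have h2 := DFunLike.congr_fun (hq.lift_comp g' hfac) ⟨t, ht⟩
  exact h1.trans h2

/-- The plane `ℝ × ℝ` as the complex line. -/
noncomputable abbrev planeEquiv : (ℝ × ℝ) ≃L[ℝ] ℂ := equivRealProdCLM.symm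

/-- A nonzero power of `z - p`, up to a factor without zeros in `B`, has no continuous logarithm
along the boundary of a bounded open set `B` containing `p`. -/
theorem eq_zero_of_exp_eq_zpow_mul {B : Set (ℝ × ℝ)} (hBo : IsOpen B)
    (hBb : Bornology.IsBounded B) {p : ℝ × ℝ} (hp : p ∈ B) {φ : ℝ × ℝ → ℂ}
    (hφ : ContinuousOn φ (closure B)) (hφ0 : ∀ z ∈ closure B, φ z ≠ 0) (G : C(ℝ × ℝ, ℂ)) (a : ℤ)
    (h : ∀ z ∈ frontier B, exp (G z) = (planeEquiv z - planeEquiv p) ^ a * φ z) : a = 0 := by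
  classical
  have hne {z : ℝ × ℝ} (hz : z ∉ B) : planeEquiv z - planeEquiv p ≠ 0 :=
    sub_ne_zero.2 fun H ↦ hz (planeEquiv.injective H ▸ hp)
  set H : ℝ × ℝ → ℂ :=
    (closure B).piecewise (fun z ↦ exp (G z) / φ z) fun z ↦ (planeEquiv z - planeEquiv p) ^ a with hH
  have hHc : Continuous H := by
    refine continuous_piecewise (fun z hz ↦ ?_) ?_ fun z hz ↦ ?_
    · have hz' := frontier_closure_subset hz
      rw [h z hz', mul_div_cancel_right₀ _ (hφ0 z (frontier_subset_closure hz'))]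
    · rw [closure_closure]
      exact (by fun_prop : Continuous fun z ↦ exp (G z)).continuousOn.div hφ hφ0
    · have hz' : z ∉ B := closure_minimal (compl_subset_compl.2 subset_closure)
        hBo.isClosed_compl hz
      have hc : ContinuousAt (fun z ↦ planeEquiv z - planeEquiv p) z := by fun_prop
      exact (hc.zpow₀ a (Or.inl (hne hz'))).continuousWithinAt
  have hH0 (z) : H z ≠ 0 := by
    by_cases hz : z ∈ closure B
    · rw [hH, piecewise_eq_of_mem _ _ _ hz]
      exact div_ne_zero (exp_ne_zero _) (hφ0 z hz)
    · rw [hH, piecewise_eq_of_notMem _ _ _ hz]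
      exact zpow_ne_zero _ (hne fun h ↦ hz (subset_closure h))
  obtain ⟨L, hLc, hL⟩ := exists_continuous_log hHc hH0
  obtain ⟨C, hC⟩ := (planeEquiv.lipschitz.isBounded_image hBb.closure).exists_norm_le
  set R : ℝ := |C| + ‖planeEquiv p‖ + 1 with hR
  have hR0 : (R : ℂ) ≠ 0 := by
    rw [Ne, ofReal_eq_zero]; positivity
  let P (t : ℝ) : ℝ × ℝ := planeEquiv.symm (planeEquiv p + R * exp (t * I))
  have hP (t : ℝ) : planeEquiv (P t) - planeEquiv p = R * exp (t * I) := by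
    simp only [P, ContinuousLinearEquiv.apply_symm_apply, add_sub_cancel_left]
  have hPB (t : ℝ) : P t ∉ closure B := fun hmem ↦ by
    have h1 := hC _ (mem_image_of_mem planeEquiv hmem)
    have h2 : ‖planeEquiv (P t) - planeEquiv p‖ = R := by
      rw [hP, norm_mul, norm_exp_ofReal_mul_I, mul_one, norm_real, Real.norm_of_nonneg]
      positivity
    have h3 := norm_sub_le (planeEquiv (P t)) (planeEquiv p)
    have h4 := le_abs_self C
    linarith
  have hLP (t : ℝ) : exp (L (P t)) = (R : ℂ) ^ a * exp (a * (t * I)) := by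
    rw [hL, hH, piecewise_eq_of_notMem _ _ _ (hPB t), hP, mul_zpow, exp_int_mul]
  have key := eq_of_exp_eq (g₁ := fun t : ℝ ↦ L (P t)) (g₂ := fun t : ℝ ↦ L (P 0) + a * (t * I))
    (by fun_prop) (by fun_prop) (fun t ↦ by rw [hLP, exp_add, hLP]; simp) (a := 0) (by simp)
  have h2π := congrFun key (2 * Real.pi)
  have hPp : P (2 * Real.pi) = P 0 := by simp [P]
  simpa [hPp, Real.pi_ne_zero] using h2π

end Logarithms

section Components

theorem closure_subset_union_of_connectedComponentIn {E : Type*} [TopologicalSpace E]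
    [LocallyConnectedSpace E] {K U : Set E} (hK : IsClosed K)
    (hU : ∀ z ∈ Kᶜ, ∀ w ∈ connectedComponentIn Kᶜ z, w ∈ U → z ∈ U) : closure U ⊆ U ∪ K := by
  intro z hz
  by_cases hzK : z ∈ K
  · exact Or.inr hzK
  obtain ⟨w, hw, hwU⟩ := mem_closure_iff.1 hz _ (hK.isOpen_compl.connectedComponentIn (x := z))
    (mem_connectedComponentIn hzK)
  exact Or.inl (hU z hzK w hw hwU)

theorem closure_connectedComponentIn_compl_subset {E : Type*} [TopologicalSpace E]
    [LocallyConnectedSpace E] {K : Set E} (hK : IsClosed K) (p : E) :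
    closure (connectedComponentIn Kᶜ p) ⊆ connectedComponentIn Kᶜ p ∪ K :=
  closure_subset_union_of_connectedComponentIn hK fun z hz w hw hwp ↦ by
    rw [connectedComponentIn_eq hwp, ← connectedComponentIn_eq hw]
    exact mem_connectedComponentIn hz

theorem frontier_connectedComponentIn_compl_subset {E : Type*} [TopologicalSpace E]
    [LocallyConnectedSpace E] {K : Set E} (hK : IsClosed K) (p : E) :
    frontier (connectedComponentIn Kᶜ p) ⊆ K := fun z hz ↦ by
  rw [hK.isOpen_compl.connectedComponentIn.frontier_eq] at hz
  exact (closure_connectedComponentIn_compl_subset hK p hz.1).resolve_left hz.2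

theorem not_isBounded_connectedComponentIn_compl_of_norm_lt {E : Type*} [NormedAddCommGroup E]
    [NormedSpace ℝ E] {K : Set E} {R : ℝ} (hR : 0 ≤ R) (hK : ∀ z ∈ K, ‖z‖ ≤ R) {z : E}
    (hz : R < ‖z‖) :
    ¬ Bornology.IsBounded (connectedComponentIn Kᶜ z) := by
  intro hb
  obtain ⟨C, hC⟩ := hb.exists_norm_le
  have hsub : (fun t : ℝ ↦ t • z) '' Ici 1 ⊆ connectedComponentIn Kᶜ z := by
    refine (isPreconnected_Ici.image _ (by fun_prop)).subset_connectedComponentIn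
      ⟨1, by simp, one_smul _ _⟩ ?_
    rintro _ ⟨t, ht, rfl⟩ hmem
    have h1 := hK _ hmem
    simp only [norm_smul, Real.norm_eq_abs] at h1
    have h2 : 1 ≤ |t| := le_trans ht (le_abs_self t)
    nlinarith
  have hmem : (1 : ℝ) ≤ (|C| + 1) / ‖z‖ + 1 := le_add_of_nonneg_left (by positivity)
  have h1 := hC _ (hsub ⟨_, hmem, rfl⟩)
  have hz0 : 0 < ‖z‖ := hR.trans_lt hz
  rw [norm_smul, Real.norm_of_nonneg (by positivity), add_mul, div_mul_cancel₀ _ hz0.ne'] at h1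
  linarith [le_abs_self C]

end Components

theorem not_isBounded_connectedComponentIn_compl_arc {σ : ℝ → ℝ × ℝ} (hσ : Continuous σ) {a b : ℝ}
    (hinj : InjOn σ (Icc a b)) {p : ℝ × ℝ} (hp : ∀ t, σ t ≠ p) :
    ¬ Bornology.IsBounded (connectedComponentIn (σ '' Icc a b)ᶜ p) := by
  intro hb
  have hA : IsClosed (σ '' Icc a b) := (isCompact_Icc.image hσ).isClosed
  obtain ⟨g, hg, hgσ⟩ := exists_continuous_log (f := fun t ↦ planeEquiv (σ t) - planeEquiv p)
    (by fun_prop) fun t ↦ sub_ne_zero.2 (planeEquiv.injective.ne (hp t))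
  obtain ⟨G, hG⟩ := exists_continuousMap_comp_eq hσ hg a b fun s hs t ht hst ↦ by
    rw [hinj hs ht hst]
  refine (one_ne_zero (α := ℤ)) (eq_zero_of_exp_eq_zpow_mul hA.isOpen_compl.connectedComponentIn hb
    (mem_connectedComponentIn ?_) (φ := fun _ ↦ 1) continuousOn_const (by simp) G 1 fun z hz ↦ ?_)
  · rintro ⟨t, -, ht⟩
    exact hp t ht
  · obtain ⟨t, ht, rfl⟩ := frontier_connectedComponentIn_compl_subset hA p hz
    simp [hG t ht, hgσ]

namespace IsJordanCurve

variable {Y : Set (ℝ × ℝ)}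

theorem isCompact (hY : IsJordanCurve Y) : IsCompact Y := by
  obtain ⟨γ, hγ, -, rfl⟩ := hY
  exact isCompact_range hγ

theorem nonempty (hY : IsJordanCurve Y) : Y.Nonempty := by
  obtain ⟨γ, hγ, -, rfl⟩ := hY
  exact range_nonempty γ

/-- A Jordan curve is parametrized by `[0, 2π]`, starting at any given point, so that only the
endpoints are identified. -/
theorem exists_parametrization (hY : IsJordanCurve Y) {y : ℝ × ℝ} (hy : y ∈ Y) :
    ∃ σ : ℝ → ℝ × ℝ, Continuous σ ∧ σ 0 = y ∧ σ (2 * Real.pi) = y ∧ (∀ t, σ t ∈ Y) ∧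
      σ '' Icc 0 (2 * Real.pi) = Y ∧ InjOn σ (Ico 0 (2 * Real.pi)) := by
  obtain ⟨γ, hγ, hinj, rfl⟩ := hY
  obtain ⟨c, rfl⟩ := hy
  refine ⟨fun t ↦ γ (c * Circle.exp t), by fun_prop, by simp, by simp, fun _ ↦ mem_range_self _,
    ?_, ?_⟩
  · refine Subset.antisymm (by rintro _ ⟨t, -, rfl⟩; exact mem_range_self _) ?_
    rintro _ ⟨d, rfl⟩
    obtain ⟨s, hs⟩ := Circle.exp_surjective (c⁻¹ * d)
    obtain ⟨t, ht, hst⟩ := Circle.periodic_exp.exists_mem_Ico₀ Real.two_pi_pos s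
    exact ⟨t, Ico_subset_Icc_self ht, by simp [← hst, hs]⟩
  · exact fun s hs t ht hst ↦ Circle.exp_injOn_Ico (by simp) hs ht (mul_left_cancel (hinj hst))

/-- The complement of a Jordan curve has at most one bounded component. -/
theorem connectedComponentIn_eq_of_isBounded (hY : IsJordanCurve Y) {p q : ℝ × ℝ} (hp : p ∈ Yᶜ)
    (hq : q ∈ Yᶜ) (hbp : Bornology.IsBounded (connectedComponentIn Yᶜ p))
    (hbq : Bornology.IsBounded (connectedComponentIn Yᶜ q)) :
    connectedComponentIn Yᶜ p = connectedComponentIn Yᶜ q := by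
  by_contra hpq
  have hYc := hY.isCompact.isClosed
  obtain ⟨y, hy⟩ := hY.nonempty
  obtain ⟨σ, hσ, h0, h2π, hmem, hσY, hinj⟩ := hY.exists_parametrization hy
  have hlog {r : ℝ × ℝ} (hr : r ∈ Yᶜ) : ∃ g : ℝ → ℂ, Continuous g ∧
      (∀ t, exp (g t) = planeEquiv (σ t) - planeEquiv r) ∧
      ∃ n : ℤ, g (2 * Real.pi) = g 0 + n * (2 * Real.pi * I) := by
    obtain ⟨g, hg, hgσ⟩ := exists_continuous_log (f := fun t ↦ planeEquiv (σ t) - planeEquiv r)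
      (by fun_prop)
      fun t ↦ sub_ne_zero.2 (planeEquiv.injective.ne (ne_of_mem_of_not_mem (hmem t) hr))
    exact ⟨g, hg, hgσ, exp_eq_exp_iff_exists_int.1 (by rw [hgσ, hgσ, h0, h2π])⟩
  obtain ⟨g, hg, hgσ, m, hm⟩ := hlog hp
  obtain ⟨k, hk, hkσ, n, hn⟩ := hlog hq
  have key (a b : ℤ) (hab : a * m + b * n = 0) : ∃ G : C(ℝ × ℝ, ℂ), ∀ z ∈ Y,
      exp (G z) = (planeEquiv z - planeEquiv p) ^ a * (planeEquiv z - planeEquiv q) ^ b := by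
    have hper : a * g (2 * Real.pi) + b * k (2 * Real.pi) = a * g 0 + b * k 0 := by
      have : (a * m + b * n : ℂ) = 0 := mod_cast hab
      rw [hm, hn]
      linear_combination (2 * Real.pi * I) * this
    obtain ⟨G, hG⟩ := exists_continuousMap_comp_eq (g := fun t ↦ a * g t + b * k t) hσ
      (by fun_prop) 0 (2 * Real.pi) fun s hs t ht hst ↦ by
        rcases hs.2.eq_or_lt with rfl | hs' <;> rcases ht.2.eq_or_lt with rfl | ht'
        · rfl
        · rw [hper, ← hinj ⟨le_rfl, Real.two_pi_pos⟩ ⟨ht.1, ht'⟩ (by rw [h0, ← h2π, hst])]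
        · rw [hper, ← hinj ⟨le_rfl, Real.two_pi_pos⟩ ⟨hs.1, hs'⟩ (by rw [h0, ← h2π, hst])]
        · rw [hinj ⟨hs.1, hs'⟩ ⟨ht.1, ht'⟩ hst]
    refine ⟨G, ?_⟩
    rw [← hσY]
    rintro _ ⟨t, ht, rfl⟩
    rw [hG t ht, exp_add, exp_int_mul, exp_int_mul, hgσ, hkσ]
  have hn0 : n ≠ 0 := by
    rintro rfl
    obtain ⟨G, hG⟩ := key 0 1 (by simp)
    refine (one_ne_zero (α := ℤ)) (eq_zero_of_exp_eq_zpow_mul hYc.isOpen_compl.connectedComponentIn hbq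
      (mem_connectedComponentIn hq) (φ := fun _ ↦ 1) continuousOn_const (by simp) G 1 fun z hz ↦ ?_)
    simp [hG z (frontier_connectedComponentIn_compl_subset hYc q hz)]
  obtain ⟨G, hG⟩ := key n (-m) (by ring)
  have hqp {z : ℝ × ℝ} (hz : z ∈ closure (connectedComponentIn Yᶜ p)) :
      planeEquiv z - planeEquiv q ≠ 0 := by
    refine sub_ne_zero.2 (planeEquiv.injective.ne ?_)
    rintro rfl
    exact hpq (connectedComponentIn_eq
      ((closure_connectedComponentIn_compl_subset hYc p hz).resolve_right hq))
  exact hn0 (eq_zero_of_exp_eq_zpow_mul hYc.isOpen_compl.connectedComponentIn hbp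
    (mem_connectedComponentIn hp) (φ := fun z ↦ (planeEquiv z - planeEquiv q) ^ (-m))
    (ContinuousOn.zpow₀ (by fun_prop) _ fun z hz ↦ Or.inl (hqp hz))
    (fun z hz ↦ zpow_ne_zero _ (hqp hz)) G n
    fun z hz ↦ hG z (frontier_connectedComponentIn_compl_subset hYc p hz))

/-- If the complement of a Jordan curve has a bounded component, then every point of the curve is
a limit of points in unbounded components. -/
theorem subset_closure_unbounded (hY : IsJordanCurve Y) {p : ℝ × ℝ} (hp : p ∈ Yᶜ)
    (hbp : Bornology.IsBounded (connectedComponentIn Yᶜ p)) :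
    Y ⊆ closure {z ∈ Yᶜ | ¬ Bornology.IsBounded (connectedComponentIn Yᶜ z)} := by
  set U := {z ∈ Yᶜ | ¬ Bornology.IsBounded (connectedComponentIn Yᶜ z)}
  have hYc := hY.isCompact.isClosed
  have hUo : IsOpen U := by
    refine isOpen_iff_mem_nhds.2 fun z hz ↦ Filter.mem_of_superset
      (hYc.isOpen_compl.connectedComponentIn.mem_nhds (mem_connectedComponentIn hz.1))
      fun w hw ↦ ⟨connectedComponentIn_subset _ _ hw, ?_⟩
    rw [← connectedComponentIn_eq hw]
    exact hz.2
  have hUY : closure U ⊆ U ∪ Y := closure_subset_union_of_connectedComponentIn hYc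
    fun z hz w hw hwU ↦ ⟨hz, by rw [connectedComponentIn_eq hw]; exact hwU.2⟩
  intro y hy
  by_contra hyU
  obtain ⟨σ, hσ, h0, h2π, hmem, hσY, hinj⟩ := hY.exists_parametrization hy
  have hnear {s : ℝ} (hs : σ s = y) : ∀ᶠ t in 𝓝 s, σ t ∈ (closure U)ᶜ :=
    hσ.continuousAt.eventually_mem (isClosed_closure.isOpen_compl.mem_nhds (by rwa [hs]))
  obtain ⟨δ₁, hδ₁, h₁⟩ := Metric.eventually_nhds_iff.1 (hnear h0)
  obtain ⟨δ₂, hδ₂, h₂⟩ := Metric.eventually_nhds_iff.1 (hnear h2π)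
  set δ := min δ₁ δ₂ / 2 with hδ
  have hmin : 0 < min δ₁ δ₂ := lt_min hδ₁ hδ₂
  have hmin₁ := min_le_left δ₁ δ₂
  have hmin₂ := min_le_right δ₁ δ₂
  set A := σ '' Icc δ (2 * Real.pi - δ)
  have hAY : A ⊆ Y := hσY ▸ image_mono (Icc_subset_Icc (by linarith) (by linarith))
  have hYA : closure U ∩ Y ⊆ A := by
    rw [← hσY]
    rintro _ ⟨hz, t, ht, rfl⟩
    refine ⟨t, ⟨?_, ?_⟩, rfl⟩ <;> by_contra! hlt
    · refine h₁ ?_ hz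
      rw [Real.dist_eq, abs_lt]
      constructor <;> linarith [ht.1]
    · refine h₂ ?_ hz
      rw [Real.dist_eq, abs_lt]
      constructor <;> linarith [ht.2]
  have hunb : ¬ Bornology.IsBounded (connectedComponentIn Aᶜ p) :=
    not_isBounded_connectedComponentIn_compl_arc hσ
      (hinj.mono (Icc_subset_Ico (by linarith) (by linarith)))
      fun t ↦ ne_of_mem_of_not_mem (hmem t) hp
  obtain ⟨R, hR0, hR⟩ := hY.isCompact.isBounded.exists_pos_norm_le
  obtain ⟨z, hz, hzR⟩ : ∃ z ∈ connectedComponentIn Aᶜ p, R < ‖z‖ := by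
    by_contra! H
    exact hunb (isBounded_iff_forall_norm_le.2 ⟨R, H⟩)
  have hzU : z ∈ U := ⟨fun hzY ↦ (hR z hzY).not_gt hzR,
    not_isBounded_connectedComponentIn_compl_of_norm_lt hR0.le hR hzR⟩
  have hsub := isPreconnected_connectedComponentIn.subset_of_closure_inter_subset hUo ⟨z, hz, hzU⟩
    fun w hw ↦ (hUY hw.1).resolve_right fun hwY ↦
      connectedComponentIn_subset _ _ hw.2 (hYA ⟨hw.1, hwY⟩)
  exact (hsub (mem_connectedComponentIn fun h ↦ hp (hAY h))).2 hbp

end IsJordanCurve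

/-- The image identity of Lemma B.1: under the hypotheses of the topological
lemma, `f(B_X) = B_Y`. -/
theorem stmt_11 (X Y BX BY : Set (ℝ × ℝ))
    (hX : IsJordanCurve X) (hY : IsJordanCurve Y)
    (hBX : IsJordanInterior X BX) (hBY : IsJordanInterior Y BY)
    (f : ℝ × ℝ → ℝ × ℝ)
    (hfc : ContinuousOn f (closure BX))
    (hloc : IsLocalHomeomorphOn f BX)
    (hbdd : Bornology.IsBounded (f '' BX))
    (hXY : f '' X ⊆ Y) :
    f '' BX = BY := by
  obtain ⟨hBXb, x, hx, rfl⟩ := hBX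
  obtain ⟨hBYb, p, hp, rfl⟩ := hBY
  set B := connectedComponentIn Xᶜ x
  have hXc := hX.isCompact.isClosed
  have hYc := hY.isCompact.isClosed
  have hBo : IsOpen B := hXc.isOpen_compl.connectedComponentIn
  have hWo : IsOpen (f '' B) := by
    refine isOpen_iff_mem_nhds.2 ?_
    rintro _ ⟨z, hz, rfl⟩
    rw [← hloc.map_nhds_eq hz]
    exact Filter.image_mem_map (hBo.mem_nhds hz)
  have hWcl : closure (f '' B) ⊆ f '' B ∪ Y := by
    refine (closure_minimal (image_mono subset_closure)
      (hBXb.isCompact_closure.image_of_continuousOn hfc).isClosed).trans ?_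
    refine (image_mono (closure_connectedComponentIn_compl_subset hXc x)).trans ?_
    rw [image_union]
    exact union_subset_union_right (f '' B) hXY
  have hcomp {w : ℝ × ℝ} (hw : w ∈ f '' B) (hwY : w ∈ Yᶜ) :
      connectedComponentIn Yᶜ w ⊆ f '' B :=
    isPreconnected_connectedComponentIn.subset_of_closure_inter_subset hWo
      ⟨w, mem_connectedComponentIn hwY, hw⟩ fun z hz ↦
        (hWcl hz.1).resolve_right (connectedComponentIn_subset _ _ hz.2)
  have hWY : f '' B ⊆ Yᶜ := fun y hy hyY ↦ by
    obtain ⟨u, hu, huY, hub⟩ :=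
      mem_closure_iff.1 (hY.subset_closure_unbounded hp hBYb hyY) _ hWo hy
    exact hub (hbdd.subset (hcomp hu huY))
  have heq {w : ℝ × ℝ} (hw : w ∈ f '' B) :
      connectedComponentIn Yᶜ w = connectedComponentIn Yᶜ p :=
    hY.connectedComponentIn_eq_of_isBounded (hWY hw) hp (hbdd.subset (hcomp hw (hWY hw))) hBYb
  have hfx : f x ∈ f '' B := mem_image_of_mem f (mem_connectedComponentIn hx)
  refine Subset.antisymm (fun w hw ↦ heq hw ▸ mem_connectedComponentIn (hWY hw)) ?_
  exact heq hfx ▸ hcomp hfx (hWY hfx)
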